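/- Fix θ₀ ∈ Θ and suppose the covariance matrix Σ^{μ_{θ₀}} = (Cov_{μ_{θ₀}}(f_i,f_j))_{1≤i,j≤d} has full rank. Let (X_k)_{k≥0} be the coordinate process distributed according to μ_{θ₀} and put α_n := (1/n) S_{[X₀,…,X_{n−1}]} F⃗ ∈ ℝ^{d+1}, where F⃗ = (f₀,…,f_d). Then almost surely, for all sufficiently large n the function t ↦ ⟨α_n,(1,t)⟩ − P(F_t) attains a unique maximum at some point θ̃_n ∈ ℝ^d, and θ̃_n → θ₀ almost surely as n → ∞. -/

import Mathlib

open MeasureTheory Filter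

namespace GibbsPaper

/-- Prepend a symbol to a one-sided sequence. -/
def cons {a : ℕ} (i : Fin a) (x : ℕ → Fin a) : ℕ → Fin a
  | 0 => i
  | n + 1 => x n

/-- The left shift on sequence space. -/
def shift {a : ℕ} (x : ℕ → Fin a) : ℕ → Fin a := fun n => x (n + 1)

/-- The subshift of finite type determined by the incidence matrix `A`. -/
def SFT {a : ℕ} (A : Fin a → Fin a → Bool) : Set (ℕ → Fin a) :=
  {x | ∀ n, A (x n) (x (n + 1)) = true}

/-- Topological mixing of the subshift, phrased via admissible connecting words. -/
def Mixing {a : ℕ} (A : Fin a → Fin a → Bool) : Prop :=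
  ∃ N : ℕ, ∀ n ≥ N, ∀ i j : Fin a, ∃ w : ℕ → Fin a,
    w 0 = i ∧ w n = j ∧ ∀ k < n, A (w k) (w (k + 1)) = true

/-- Birkhoff sum `S_n h = ∑_{k<n} h ∘ σ^k`. -/
def birkhoff {a : ℕ} (n : ℕ) (h : (ℕ → Fin a) → ℝ) (x : ℕ → Fin a) : ℝ :=
  ∑ k ∈ Finset.range n, h (shift^[k] x)

/-- Hölder continuity with respect to the cylinder (product) structure. -/
def HolderSeq {a : ℕ} (f : (ℕ → Fin a) → ℝ) : Prop :=
  Continuous f ∧ ∃ C ρ : ℝ, 0 < ρ ∧ ρ < 1 ∧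
    ∀ n : ℕ, ∀ x y : ℕ → Fin a, (∀ i < n, x i = y i) → |f x - f y| ≤ C * ρ ^ n

/-- The cylinder `[c₀,…,c_{n-1}]` inside the subshift `Ω = SFT A`. -/
def cyl {a : ℕ} (A : Fin a → Fin a → Bool) (n : ℕ) (c : ℕ → Fin a) : Set (ℕ → Fin a) :=
  {x ∈ SFT A | ∀ i < n, x i = c i}

/-- The Ruelle transfer operator `L_F g (x) = ∑_{σ y = x} e^{F y} g y`. -/
noncomputable def transfer {a : ℕ} (A : Fin a → Fin a → Bool)
    (F g : (ℕ → Fin a) → ℝ) (x : ℕ → Fin a) : ℝ :=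
  ∑ i : Fin a, if A i (x 0) = true then Real.exp (F (cons i x)) * g (cons i x) else 0

/-- `ν` is a probability eigenmeasure of the dual transfer operator `L_F^*` with
eigenvalue `lam`, supported on the subshift. -/
def Eigenmeasure {a : ℕ} (A : Fin a → Fin a → Bool) (F : (ℕ → Fin a) → ℝ)
    (lam : ℝ) (ν : Measure (ℕ → Fin a)) : Prop :=
  IsProbabilityMeasure ν ∧ ν (SFT A)ᶜ = 0 ∧
    ∀ g : (ℕ → Fin a) → ℝ, Continuous g →
      ∫ x, transfer A F g x ∂ν = lam * ∫ x, g x ∂ν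

/-- The thermodynamic data on a subshift of finite type: for every Hölder continuous
potential `F`, the pressure `P F`, the Gibbs eigenmeasure `ν F` (the unique probability
measure with `L_F^* ν = e^{P F} ν`) and the positive Hölder continuous eigenfunction
`φ F` with `L_F (φ F) = e^{P F} φ F`, `∫ φ F dν F = 1`. -/
structure GibbsData (a : ℕ) (A : Fin a → Fin a → Bool) where
  P : ((ℕ → Fin a) → ℝ) → ℝ
  ν : ((ℕ → Fin a) → ℝ) → Measure (ℕ → Fin a)
  φ : ((ℕ → Fin a) → ℝ) → (ℕ → Fin a) → ℝ
  eigen : ∀ F, HolderSeq F → Eigenmeasure A F (Real.exp (P F)) (ν F)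
  unique : ∀ F, HolderSeq F → ∀ lam ν', Eigenmeasure A F lam ν' →
    lam = Real.exp (P F) ∧ ν' = ν F
  φ_holder : ∀ F, HolderSeq F → HolderSeq (φ F)
  φ_pos : ∀ F, HolderSeq F → ∀ x ∈ SFT A, 0 < φ F x
  φ_eigen : ∀ F, HolderSeq F → ∀ x ∈ SFT A,
    transfer A F (φ F) x = Real.exp (P F) * φ F x
  φ_norm : ∀ F, HolderSeq F → ∫ x, φ F x ∂(ν F) = 1

/-- The shift-invariant Gibbs measure `μ_F = φ_F ν_F`. -/
noncomputable def GibbsData.μ {a : ℕ} {A : Fin a → Fin a → Bool} (G : GibbsData a A)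
    (F : (ℕ → Fin a) → ℝ) : Measure (ℕ → Fin a) :=
  (G.ν F).withDensity (fun x => ENNReal.ofReal (G.φ F x))

/-- The linearly parametrized potential `F_t = f₀ + ∑ i, t i • f i`. -/
def Fpot {a d : ℕ} (f₀ : (ℕ → Fin a) → ℝ) (f : Fin d → (ℕ → Fin a) → ℝ)
    (t : Fin d → ℝ) : (ℕ → Fin a) → ℝ :=
  fun x => f₀ x + ∑ i : Fin d, t i * f i x

/-- The vector `F⃗ = (f₀, f₁, …, f_d)`. -/
def Fvec {a d : ℕ} (f₀ : (ℕ → Fin a) → ℝ) (f : Fin d → (ℕ → Fin a) → ℝ) :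
    Fin (d + 1) → (ℕ → Fin a) → ℝ :=
  Fin.cons f₀ f

/-- `Covμ μ f g c` : the asymptotic covariance
`lim (1/m) ∫ S_m(f - ∫ f dμ) S_m(g - ∫ g dμ) dμ` exists and equals `c`. -/
def Covμ {a : ℕ} (μ : Measure (ℕ → Fin a)) (f g : (ℕ → Fin a) → ℝ) (c : ℝ) : Prop :=
  Tendsto (fun m : ℕ => (1 / (m : ℝ)) *
      ∫ x, birkhoff m (fun y => f y - ∫ z, f z ∂μ) x *
        birkhoff m (fun y => g y - ∫ z, g z ∂μ) x ∂μ)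
    atTop (nhds c)

/-- `f` and `g` are cohomologous (on the subshift): `g - f = c + h - h∘σ`. -/
def Cohomologous {a : ℕ} (A : Fin a → Fin a → Bool) (f g : (ℕ → Fin a) → ℝ) : Prop :=
  ∃ c : ℝ, ∃ h : (ℕ → Fin a) → ℝ, Continuous h ∧
    ∀ x ∈ SFT A, g x - f x = c + h x - h (shift x)

/-- `(f₁,…,f_d)` is linearly independent as cohomology classes. -/
def LinIndepCohom {a d : ℕ} (A : Fin a → Fin a → Bool)
    (f : Fin d → (ℕ → Fin a) → ℝ) : Prop :=
  ∀ s : Fin d → ℝ,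
    Cohomologous A (fun _ => 0) (fun x => ∑ i : Fin d, s i * f i x) → s = 0

/-- The supremum of the Birkhoff sum `S_n g` over the cylinder `[c₀,…,c_{n-1}]`. -/
noncomputable def supCyl {a : ℕ} (A : Fin a → Fin a → Bool) (n : ℕ)
    (g : (ℕ → Fin a) → ℝ) (c : ℕ → Fin a) : ℝ :=
  sSup (birkhoff n g '' cyl A n c)

/-- The constraint set `Θ_n^η(x)` of Definition 2.1. -/
noncomputable def ThetaSet {a d : ℕ} (A : Fin a → Fin a → Bool)
    (G : GibbsData a A) (f₀ : (ℕ → Fin a) → ℝ) (f : Fin d → (ℕ → Fin a) → ℝ)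
    (Θ : Set (Fin d → ℝ)) (η : ℝ) (n : ℕ) (x : ℕ → Fin a) : Set (Fin d → ℝ) :=
  {s ∈ Θ | (∀ i : Fin d, |s i| ≤ 1 / η) ∧
    ∀ i : Fin (d + 1),
      |(1 / (n : ℝ)) * supCyl A n (Fvec f₀ f i) x -
        ∫ z, Fvec f₀ f i z ∂(G.μ (Fpot f₀ f s))| ≤ η ^ 2}

/-- `est` is an `η`-maximum likelihood estimator at stage `n` for the data `x`:
it lies in `Θ_n^η(x)` and maximizes `s ↦ ν_s([x₀,…,x_{n-1}])` over `Θ_n^η(x)`. -/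
def IsMLE {a d : ℕ} (A : Fin a → Fin a → Bool) (G : GibbsData a A)
    (f₀ : (ℕ → Fin a) → ℝ) (f : Fin d → (ℕ → Fin a) → ℝ) (Θ : Set (Fin d → ℝ))
    (η : ℝ) (n : ℕ) (x : ℕ → Fin a) (est : Fin d → ℝ) : Prop :=
  est ∈ ThetaSet A G f₀ f Θ η n x ∧
    ∀ s ∈ ThetaSet A G f₀ f Θ η n x,
      G.ν (Fpot f₀ f s) (cyl A n x) ≤ G.ν (Fpot f₀ f est) (cyl A n x)

/-- Weak convergence of a sequence of measures, tested against bounded continuous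
functions. -/
def WeakTendsto {E : Type*} [TopologicalSpace E] [MeasurableSpace E]
    (μs : ℕ → Measure E) (μ : Measure E) : Prop :=
  ∀ g : BoundedContinuousFunction E ℝ,
    Tendsto (fun n => ∫ x, g x ∂(μs n)) atTop (nhds (∫ x, g x ∂μ))

/-- `γ` is the centered `d`-dimensional Gaussian distribution with covariance
matrix `Σ`, characterized through its one-dimensional projections. -/
def IsCenteredGaussian {d : ℕ} (S : Matrix (Fin d) (Fin d) ℝ)
    (γ : Measure (Fin d → ℝ)) : Prop :=
  IsProbabilityMeasure γ ∧
    ∀ l : Fin d → ℝ,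
      γ.map (fun x => ∑ i : Fin d, l i * x i) =
        ProbabilityTheory.gaussianReal 0
          (∑ i : Fin d, ∑ j : Fin d, l i * S i j * l j).toNNReal

/-- The random matrix `G(M) = MᵗM − Σ` of Theorem 2.8. -/
noncomputable def Gmat {d : ℕ} (S : Matrix (Fin d) (Fin d) ℝ) (M : Fin d → ℝ) :
    Matrix (Fin d) (Fin d) ℝ :=
  Matrix.vecMulVec M M - S

/-- The limiting random vector `G⁻¹(N)Nᵗ`. -/
noncomputable def limitVec {d : ℕ} (S : Matrix (Fin d) (Fin d) ℝ) (M : Fin d → ℝ) :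
    Fin d → ℝ :=
  (Gmat S M)⁻¹.mulVec M

end GibbsPaper

namespace GibbsPaper

/-- The objective function `t ↦ ⟨α_n, (1,t)⟩ − P(F_t)` of the maximum potential
estimator, where `α_n = (1/n) S_{[x₀,…,x_{n−1}]} F⃗`. -/
noncomputable def MPEobjective {a d : ℕ} (A : Fin a → Fin a → Bool)
    (G : GibbsData a A) (f₀ : (ℕ → Fin a) → ℝ) (f : Fin d → (ℕ → Fin a) → ℝ)
    (n : ℕ) (x : ℕ → Fin a) (t : Fin d → ℝ) : ℝ :=
  (1 / (n : ℝ)) * supCyl A n (Fvec f₀ f 0) x +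
    (∑ i : Fin d, ((1 / (n : ℝ)) * supCyl A n (Fvec f₀ f i.succ) x) * t i) -
    G.P (Fpot f₀ f t)

section Proof

open Topology Set

section Symbolic

variable {a : ℕ} {A : Fin a → Fin a → Bool}

lemma shift_cons (i : Fin a) (x : ℕ → Fin a) : shift (cons i x) = x := rfl

lemma cons_shift (y : ℕ → Fin a) : cons (y 0) (shift y) = y := by
  funext n
  cases n <;> rfl

lemma cons_mem_SFT {i : Fin a} {x : ℕ → Fin a} (hx : x ∈ SFT A) (hi : A i (x 0) = true) :
    cons i x ∈ SFT A := by
  intro n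
  cases n with
  | zero => exact hi
  | succ k => exact hx k

lemma shift_mem_SFT {x : ℕ → Fin a} (hx : x ∈ SFT A) : shift x ∈ SFT A :=
  fun n => hx (n + 1)

lemma shift_iterate_apply (k n : ℕ) (x : ℕ → Fin a) : shift^[k] x n = x (n + k) := by
  induction k generalizing n x with
  | zero => rfl
  | succ k ih =>
    rw [Function.iterate_succ_apply, ih]
    simp only [shift]
    congr 1

lemma shift_iterate_mem_SFT {x : ℕ → Fin a} (hx : x ∈ SFT A) (k : ℕ) :
    shift^[k] x ∈ SFT A := by
  intro n
  rw [shift_iterate_apply, shift_iterate_apply]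
  have := hx (n + k)
  rwa [show n + 1 + k = n + k + 1 by ring]

lemma continuous_shift : Continuous (shift : (ℕ → Fin a) → ℕ → Fin a) :=
  continuous_pi fun n => continuous_apply (n + 1)

lemma continuous_cons (i : Fin a) : Continuous (cons i : (ℕ → Fin a) → ℕ → Fin a) := by
  refine continuous_pi fun n => ?_
  cases n with
  | zero => exact continuous_const
  | succ k => exact continuous_apply k

lemma continuous_birkhoff {h : (ℕ → Fin a) → ℝ} (hh : Continuous h) (n : ℕ) :
    Continuous (birkhoff n h) :=
  continuous_finsetSum _ fun k _ => hh.comp (continuous_shift.iterate k)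

lemma birkhoff_succ (n : ℕ) (h : (ℕ → Fin a) → ℝ) (x : ℕ → Fin a) :
    birkhoff (n + 1) h x = h x + birkhoff n h (shift x) := by
  simp only [birkhoff, Finset.sum_range_succ']
  simp [Function.iterate_succ_apply, add_comm]

lemma isClosed_SFT : IsClosed (SFT A) := by
  have : SFT A = ⋂ n, {x : ℕ → Fin a | A (x n) (x (n + 1)) = true} := by
    ext x
    simp [SFT]
  rw [this]
  refine isClosed_iInter fun n => ?_
  have hc : Continuous fun x : ℕ → Fin a => A (x n) (x (n + 1)) :=
    (continuous_of_discreteTopology (f := fun p : Fin a × Fin a => A p.1 p.2)).comp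
      (f := fun x : ℕ → Fin a => (x n, x (n + 1)))
      ((continuous_apply n).prodMk (continuous_apply (n + 1)))
  exact isClosed_eq hc continuous_const

/-- In a mixing subshift every point has a preimage of some order that follows a prescribed
word. -/
lemma exists_preimage_in_cylinder (hmix : Mixing A) {z : ℕ → Fin a} (hz : z ∈ SFT A) (m : ℕ) :
    ∃ K : ℕ, ∀ x ∈ SFT A, ∃ y ∈ SFT A, (∀ i < m, y i = z i) ∧ shift^[K] y = x := by
  obtain ⟨N, hN⟩ := hmix
  refine ⟨m + N, fun x hx => ?_⟩
  obtain ⟨w, hw0, hwN, hw⟩ := hN N le_rfl (z m) (x 0)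
  refine ⟨fun k => if k < m then z k else if k < m + N then w (k - m) else x (k - m - N),
    fun k => ?_, fun i hi => by simp [hi], ?_⟩
  · rcases lt_trichotomy (k + 1) m with h | h | h
    · have := hz k
      simpa [h, (by omega : k < m)] using this
    · have hk : k < m := by omega
      have := hz k
      by_cases h0 : N = 0
      · subst h0
        have hx0 : x 0 = z (k + 1) := by rw [← hwN, hw0, h]
        simpa [hk, h, hx0] using h ▸ this
      · rw [h] at this
        simpa [hk, h, (by omega : 0 < N), hw0] using this
    · have hk : ¬ k < m := by omega
      have hk' : ¬ k + 1 < m := by omega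
      by_cases h1 : k + 1 < m + N
      · have h2 : k < m + N := by omega
        have := hw (k - m) (by omega)
        rw [show k - m + 1 = k + 1 - m by omega] at this
        simpa [hk, hk', h1, h2] using this
      · by_cases h2 : k < m + N
        · have := hw (k - m) (by omega)
          rw [show k - m + 1 = N by omega, hwN] at this
          have h3 : k + 1 - m - N = 0 := by omega
          simpa [hk, hk', h1, h2, h3] using this
        · have := hx (k - m - N)
          rw [show k - m - N + 1 = k + 1 - m - N by omega] at this
          simpa [hk, hk', h1, h2] using this
  · funext n
    rw [shift_iterate_apply]
    have h1 : ¬ n + (m + N) < m := by omega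
    have h2 : ¬ n + (m + N) < m + N := by omega
    have h3 : n + (m + N) - m - N = n := by omega
    simp only [h1, h2, h3, if_false]

/-- Neighbourhoods in sequence space contain cylinders. -/
lemma exists_cylinder_subset {U : Set (ℕ → Fin a)} (hU : IsOpen U) {z : ℕ → Fin a} (hz : z ∈ U) :
    ∃ m : ℕ, ∀ y : ℕ → Fin a, (∀ i < m, y i = z i) → y ∈ U := by
  obtain ⟨s, V, hV, hsub⟩ := isOpen_pi_iff.1 hU z hz
  refine ⟨s.sup id + 1, fun y hy => hsub fun i hi => ?_⟩
  rw [hy i (Nat.lt_succ_of_le (Finset.le_sup (f := id) hi))]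
  exact (hV i hi).2

end Symbolic

section Transfer

variable {a : ℕ} {A : Fin a → Fin a → Bool}

lemma continuous_transfer_prod {Y : Type*} [TopologicalSpace Y] {F g : Y → (ℕ → Fin a) → ℝ}
    (hF : Continuous fun p : Y × (ℕ → Fin a) => F p.1 p.2)
    (hg : Continuous fun p : Y × (ℕ → Fin a) => g p.1 p.2) :
    Continuous fun p : Y × (ℕ → Fin a) => transfer A (F p.1) (g p.1) p.2 := by
  refine continuous_finsetSum _ fun i _ => ?_
  have hb : Continuous fun p : Y × (ℕ → Fin a) => if A i (p.2 0) = true then (1 : ℝ) else 0 :=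
    (continuous_of_discreteTopology
      (f := fun j : Fin a => if A i j = true then (1 : ℝ) else 0)).comp
      ((continuous_apply 0).comp continuous_snd)
  have hc : Continuous fun p : Y × (ℕ → Fin a) => (p.1, cons i p.2) :=
    continuous_fst.prodMk ((continuous_cons i).comp continuous_snd)
  have := hb.mul ((Real.continuous_exp.comp (hF.comp hc)).mul (hg.comp hc))
  refine this.congr fun p => ?_
  by_cases h : A i (p.2 0) = true <;> simp [h]

lemma continuous_transfer {F g : (ℕ → Fin a) → ℝ} (hF : Continuous F) (hg : Continuous g) :
    Continuous (transfer A F g) :=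
  (continuous_transfer_prod (A := A) (Y := Unit) (F := fun _ => F) (g := fun _ => g)
    (hF.comp continuous_snd) (hg.comp continuous_snd)).comp
    ((continuous_const (y := ())).prodMk continuous_id)

lemma transfer_congr {F g h : (ℕ → Fin a) → ℝ} {x : ℕ → Fin a} (hx : x ∈ SFT A)
    (hgh : ∀ y ∈ SFT A, shift y = x → g y = h y) : transfer A F g x = transfer A F h x := by
  refine Finset.sum_congr rfl fun i _ => ?_
  by_cases hi : A i (x 0) = true
  · simp only [hi, if_true]
    rw [hgh _ (cons_mem_SFT hx hi) (shift_cons i x)]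
  · simp [hi]

lemma transfer_comp_shift_mul (F g h : (ℕ → Fin a) → ℝ) (x : ℕ → Fin a) :
    transfer A F (fun y => h (shift y) * g y) x = h x * transfer A F g x := by
  simp only [transfer, Finset.mul_sum, shift_cons]
  refine Finset.sum_congr rfl fun i _ => ?_
  split_ifs <;> ring

lemma transfer_add_potential (F K g : (ℕ → Fin a) → ℝ) (x : ℕ → Fin a) :
    transfer A (fun y => F y + K y) g x = transfer A F (fun y => Real.exp (K y) * g y) x := by
  simp only [transfer, Real.exp_add, mul_assoc]

lemma transfer_sub (F g h : (ℕ → Fin a) → ℝ) (x : ℕ → Fin a) :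
    transfer A F (fun y => g y - h y) x = transfer A F g x - transfer A F h x := by
  simp only [transfer, ← Finset.sum_sub_distrib]
  refine Finset.sum_congr rfl fun i _ => ?_
  split_ifs <;> ring

lemma transfer_nonneg {F g : (ℕ → Fin a) → ℝ} (hg : ∀ y, 0 ≤ g y) (x : ℕ → Fin a) :
    0 ≤ transfer A F g x := by
  refine Finset.sum_nonneg fun i _ => ?_
  split_ifs
  · exact mul_nonneg (Real.exp_pos _).le (hg _)
  · exact le_rfl

lemma transfer_pos {F g : (ℕ → Fin a) → ℝ} (hg : ∀ y, 0 ≤ g y) {y : ℕ → Fin a} (hy : y ∈ SFT A)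
    (hgy : 0 < g y) : 0 < transfer A F g (shift y) := by
  refine Finset.sum_pos' (fun i _ => ?_) ⟨y 0, Finset.mem_univ _, ?_⟩
  · split_ifs
    · exact mul_nonneg (Real.exp_pos _).le (hg _)
    · exact le_rfl
  · have : A (y 0) (shift y 0) = true := hy 0
    rw [if_pos this, cons_shift]
    exact mul_pos (Real.exp_pos _) hgy

lemma transfer_iterate_pos {F g : (ℕ → Fin a) → ℝ} (hg : ∀ y, 0 ≤ g y) {y : ℕ → Fin a}
    (hy : y ∈ SFT A) (hgy : 0 < g y) (n : ℕ) : 0 < (transfer A F)^[n] g (shift^[n] y) := by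
  induction n generalizing g y with
  | zero => exact hgy
  | succ n ih =>
    rw [Function.iterate_succ_apply, Function.iterate_succ_apply]
    exact ih (transfer_nonneg hg) (shift_mem_SFT hy) (transfer_pos hg hy hgy)

lemma continuous_transfer_iterate {F g : (ℕ → Fin a) → ℝ} (hF : Continuous F)
    (hg : Continuous g) (n : ℕ) : Continuous ((transfer A F)^[n] g) := by
  induction n generalizing g with
  | zero => exact hg
  | succ n ih => exact ih (continuous_transfer hF hg)

end Transfer

section Eigenmeasure

variable {a : ℕ} {A : Fin a → Fin a → Bool}

lemma integrable_of_continuous (ν : Measure (ℕ → Fin a)) [IsFiniteMeasure ν]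
    {g : (ℕ → Fin a) → ℝ} (hg : Continuous g) : Integrable g ν :=
  hg.integrable_of_hasCompactSupport (HasCompactSupport.of_compactSpace g)

lemma Eigenmeasure.ae_mem {F : (ℕ → Fin a) → ℝ} {lam : ℝ} {ν : Measure (ℕ → Fin a)}
    (h : Eigenmeasure A F lam ν) : ∀ᵐ x ∂ν, x ∈ SFT A :=
  mem_ae_iff.2 h.2.1

lemma Eigenmeasure.integral_iterate {F : (ℕ → Fin a) → ℝ} {lam : ℝ} {ν : Measure (ℕ → Fin a)}
    (h : Eigenmeasure A F lam ν) (hF : Continuous F) {g : (ℕ → Fin a) → ℝ} (hg : Continuous g)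
    (n : ℕ) : ∫ x, (transfer A F)^[n] g x ∂ν = lam ^ n * ∫ x, g x ∂ν := by
  induction n generalizing g with
  | zero => simp
  | succ n ih =>
    rw [Function.iterate_succ_apply, ih (continuous_transfer hF hg), h.2.2 g hg]
    ring

lemma integral_pos_of_ae_pos {ν : Measure (ℕ → Fin a)} [IsProbabilityMeasure ν]
    {g : (ℕ → Fin a) → ℝ} (hg : Continuous g) (hpos : ∀ᵐ x ∂ν, 0 < g x) : 0 < ∫ x, g x ∂ν := by
  refine (integral_pos_iff_support_of_nonneg_ae (hpos.mono fun x hx => hx.le)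
    (integrable_of_continuous ν hg)).2 ?_
  rw [(mem_ae_iff_prob_eq_one (measurableSet_support hg.measurable)).1
    (hpos.mono fun x hx => hx.ne')]
  exact one_pos

/-- Eigenmeasures on a mixing subshift have full support. -/
lemma Eigenmeasure.eq_zero_of_integral_eq_zero (hmix : Mixing A) {F : (ℕ → Fin a) → ℝ} {lam : ℝ}
    {ν : Measure (ℕ → Fin a)} (h : Eigenmeasure A F lam ν) (hF : Continuous F)
    {g : (ℕ → Fin a) → ℝ} (hg : Continuous g) (hg0 : ∀ x ∈ SFT A, 0 ≤ g x)
    (hgint : ∫ x, g x ∂ν = 0) {z : ℕ → Fin a} (hz : z ∈ SFT A) : g z = 0 := by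
  have := h.1
  by_contra hne
  have hgz : 0 < g z := lt_of_le_of_ne (hg0 z hz) (Ne.symm hne)
  set k : (ℕ → Fin a) → ℝ := fun x => max (g x) 0 with hk
  have hkc : Continuous k := hg.max continuous_const
  have hk0 : ∀ y, 0 ≤ k y := fun y => le_max_right _ _
  have hkint : ∫ x, k x ∂ν = 0 := by
    rw [← hgint]
    refine integral_congr_ae (h.ae_mem.mono fun x hx => ?_)
    exact max_eq_left (hg0 x hx)
  obtain ⟨m, hm⟩ := exists_cylinder_subset (isOpen_lt continuous_const hg) hgz
  obtain ⟨K, hK⟩ := exists_preimage_in_cylinder hmix hz m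
  have hpos : 0 < ∫ x, (transfer A F)^[K] k x ∂ν := by
    refine integral_pos_of_ae_pos (continuous_transfer_iterate hF hkc K)
      (h.ae_mem.mono fun x hx => ?_)
    obtain ⟨y, hy, hyz, rfl⟩ := hK x hx
    exact transfer_iterate_pos hk0 hy (lt_max_of_lt_left (hm y hyz)) K
  rw [h.integral_iterate hF hkc, hkint, mul_zero] at hpos
  exact lt_irrefl _ hpos

end Eigenmeasure

section Holder

variable {a d : ℕ}

lemma HolderSeq.add {F H : (ℕ → Fin a) → ℝ} (hF : HolderSeq F) (hH : HolderSeq H) :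
    HolderSeq fun x => F x + H x := by
  obtain ⟨hFc, C, ρ, hρ0, hρ1, hC⟩ := hF
  obtain ⟨hHc, D, τ, hτ0, hτ1, hD⟩ := hH
  refine ⟨hFc.add hHc, |C| + |D|, max ρ τ, lt_max_of_lt_left hρ0, max_lt hρ1 hτ1,
    fun n x y hxy => ?_⟩
  have h1 : C * ρ ^ n ≤ |C| * max ρ τ ^ n :=
    mul_le_mul (le_abs_self C) (pow_le_pow_left₀ hρ0.le (le_max_left _ _) n)
      (pow_nonneg hρ0.le n) (abs_nonneg C)
  have h2 : D * τ ^ n ≤ |D| * max ρ τ ^ n :=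
    mul_le_mul (le_abs_self D) (pow_le_pow_left₀ hτ0.le (le_max_right _ _) n)
      (pow_nonneg hτ0.le n) (abs_nonneg D)
  calc |F x + H x - (F y + H y)| = |(F x - F y) + (H x - H y)| := by ring_nf
    _ ≤ |F x - F y| + |H x - H y| := abs_add_le _ _
    _ ≤ C * ρ ^ n + D * τ ^ n := add_le_add (hC n x y hxy) (hD n x y hxy)
    _ ≤ (|C| + |D|) * max ρ τ ^ n := by linarith

lemma HolderSeq.const_mul {F : (ℕ → Fin a) → ℝ} (hF : HolderSeq F) (c : ℝ) :
    HolderSeq fun x => c * F x := by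
  obtain ⟨hFc, C, ρ, hρ0, hρ1, hC⟩ := hF
  refine ⟨hFc.const_mul c, |c| * C, ρ, hρ0, hρ1, fun n x y hxy => ?_⟩
  rw [← mul_sub, abs_mul, mul_assoc]
  exact mul_le_mul_of_nonneg_left (hC n x y hxy) (abs_nonneg c)

lemma holderSeq_zero : HolderSeq fun _ : ℕ → Fin a => (0 : ℝ) :=
  ⟨continuous_const, 0, 1 / 2, by norm_num, by norm_num, fun n x y _ => by simp⟩

lemma HolderSeq.sum {ι : Type*} (s : Finset ι) {f : ι → (ℕ → Fin a) → ℝ}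
    (hf : ∀ i, HolderSeq (f i)) : HolderSeq fun x => ∑ i ∈ s, f i x := by
  classical
  induction s using Finset.induction_on with
  | empty => simpa using holderSeq_zero
  | insert i s his ih => simpa [Finset.sum_insert his] using (hf i).add ih

lemma holderSeq_combination {f : Fin d → (ℕ → Fin a) → ℝ} (hf : ∀ i, HolderSeq (f i))
    (t : Fin d → ℝ) : HolderSeq fun x => ∑ i, t i * f i x :=
  HolderSeq.sum _ fun i => (hf i).const_mul (t i)

lemma holderSeq_Fpot {f₀ : (ℕ → Fin a) → ℝ} {f : Fin d → (ℕ → Fin a) → ℝ}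
    (hf₀ : HolderSeq f₀) (hf : ∀ i, HolderSeq (f i)) (t : Fin d → ℝ) :
    HolderSeq (Fpot f₀ f t) :=
  hf₀.add (holderSeq_combination hf t)

end Holder

section Pressure

variable {a : ℕ} {A : Fin a → Fin a → Bool} (G : GibbsData a A)

/-- The eigenfunction agrees on the subshift with the exponential of a continuous function. -/
lemma exists_log_eigenfunction {F : (ℕ → Fin a) → ℝ} (hF : HolderSeq F) :
    ∃ u : (ℕ → Fin a) → ℝ, Continuous u ∧ ∀ x ∈ SFT A, Real.exp (u x) = G.φ F x := by
  rcases (SFT A).eq_empty_or_nonempty with h | h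
  · exact ⟨fun _ => 0, continuous_const, fun x hx => by simp [h] at hx⟩
  · have hc : Continuous (G.φ F) := (G.φ_holder F hF).1
    obtain ⟨z, hz, hmin⟩ := isClosed_SFT.isCompact.exists_isMinOn h hc.continuousOn
    have hz0 := G.φ_pos F hF z hz
    have hpos : ∀ x, 0 < max (G.φ F x) (G.φ F z) := fun x => lt_max_of_lt_right hz0
    refine ⟨fun x => Real.log (max (G.φ F x) (G.φ F z)),
      (hc.max continuous_const).log fun x => (hpos x).ne', fun x hx => ?_⟩
    rw [Real.exp_log (hpos x)]
    exact max_eq_left (hmin hx)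

lemma transfer_exp_eq {F u : (ℕ → Fin a) → ℝ} (hF : HolderSeq F)
    (hu : ∀ x ∈ SFT A, Real.exp (u x) = G.φ F x) {x : ℕ → Fin a} (hx : x ∈ SFT A) :
    transfer A F (fun y => Real.exp (u y)) x = Real.exp (G.P F) * Real.exp (u x) := by
  rw [transfer_congr hx fun y hy _ => hu y hy, hu x hx]
  exact G.φ_eigen F hF x hx

/-- The normalised branch weights of a potential sum to one. -/
lemma sum_normalised_weights {F u : (ℕ → Fin a) → ℝ} (hF : HolderSeq F)
    (hu : ∀ x ∈ SFT A, Real.exp (u x) = G.φ F x) {x : ℕ → Fin a} (hx : x ∈ SFT A) :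
    ∑ i : Fin a, (if A i (x 0) = true then
      Real.exp (F (cons i x) + u (cons i x) - u x - G.P F) else 0) = 1 := by
  have h := transfer_exp_eq G hF hu hx
  rw [transfer] at h
  have : ∀ i : Fin a, (if A i (x 0) = true then
      Real.exp (F (cons i x) + u (cons i x) - u x - G.P F) else 0) =
      (if A i (x 0) = true then Real.exp (F (cons i x)) * Real.exp (u (cons i x)) else 0) /
        (Real.exp (G.P F) * Real.exp (u x)) := by
    intro i
    split_ifs
    · rw [← Real.exp_add, ← Real.exp_add, ← Real.exp_sub]
      congr 1
      ring
    · simp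
  simp_rw [this]
  rw [← Finset.sum_div, h, div_self (by positivity)]

/-- A positive subsolution of the eigenvalue equation bounds the pressure, and it is a solution
when the bound is attained. -/
lemma pressure_le_of_subsolution (hmix : Mixing A) {F w : (ℕ → Fin a) → ℝ} (hF : HolderSeq F)
    (hw : Continuous w) {Q : ℝ}
    (hle : ∀ x ∈ SFT A, transfer A F (fun y => Real.exp (w y)) x ≤ Real.exp Q * Real.exp (w x)) :
    G.P F ≤ Q ∧ (G.P F = Q → ∀ x ∈ SFT A,
      transfer A F (fun y => Real.exp (w y)) x = Real.exp Q * Real.exp (w x)) := by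
  have he := G.eigen F hF
  have := he.1
  have hc : Continuous fun y => Real.exp (w y) := Real.continuous_exp.comp hw
  have htc := continuous_transfer (A := A) hF.1 hc
  have hgint := he.2.2 _ hc
  have hpos : 0 < ∫ x, Real.exp (w x) ∂(G.ν F) :=
    integral_pos_of_ae_pos hc (Eventually.of_forall fun x => Real.exp_pos _)
  have hmono : ∫ x, transfer A F (fun y => Real.exp (w y)) x ∂(G.ν F) ≤
      ∫ x, Real.exp Q * Real.exp (w x) ∂(G.ν F) :=
    integral_mono_ae (integrable_of_continuous _ htc)
      (integrable_of_continuous _ (hc.const_mul _)) (he.ae_mem.mono hle)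
  rw [hgint, integral_const_mul] at hmono
  refine ⟨Real.exp_le_exp.1 (le_of_mul_le_mul_right hmono hpos), fun hPQ x hx => ?_⟩
  have hz := he.eq_zero_of_integral_eq_zero hmix hF.1 ((hc.const_mul (Real.exp Q)).sub htc)
    (fun x hx => sub_nonneg.2 (hle x hx))
    (by
      rw [integral_sub' (integrable_of_continuous _ (hc.const_mul _))
        (integrable_of_continuous _ htc), hgint, integral_const_mul, hPQ, sub_self]) hx
  linarith [sub_eq_zero.1 hz]

/-- Convexity of the pressure along a segment; equality forces the endpoints to be
cohomologous. -/
lemma pressure_convex (hmix : Mixing A) {F H : (ℕ → Fin a) → ℝ} (hF : HolderSeq F)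
    (hH : HolderSeq H) {α β : ℝ} (hα : 0 < α) (hβ : 0 < β) (hαβ : α + β = 1) :
    G.P (fun x => α * F x + β * H x) ≤ α * G.P F + β * G.P H ∧
    (G.P (fun x => α * F x + β * H x) = α * G.P F + β * G.P H → Cohomologous A F H) := by
  obtain ⟨u, huc, hu⟩ := exists_log_eigenfunction G hF
  obtain ⟨v, hvc, hv⟩ := exists_log_eigenfunction G hH
  set Q := α * G.P F + β * G.P H with hQ
  set w : (ℕ → Fin a) → ℝ := fun x => α * u x + β * v x with hw
  have hwc : Continuous w := (huc.const_mul α).add (hvc.const_mul β)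
  have hM : HolderSeq fun x => α * F x + β * H x := (hF.const_mul α).add (hH.const_mul β)
  set p : (ℕ → Fin a) → Fin a → ℝ :=
    fun x i => F (cons i x) + u (cons i x) - u x - G.P F with hp
  set q : (ℕ → Fin a) → Fin a → ℝ :=
    fun x i => H (cons i x) + v (cons i x) - v x - G.P H with hq
  have hsum1 : ∀ x ∈ SFT A, ∑ i : Fin a, (if A i (x 0) = true then
      (α * Real.exp (p x i) + β * Real.exp (q x i)) else 0) = 1 := by
    intro x hx
    have e1 := sum_normalised_weights G hF hu hx
    have e2 := sum_normalised_weights G hH hv hx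
    calc _ = α * ∑ i : Fin a, (if A i (x 0) = true then Real.exp (p x i) else 0) +
          β * ∑ i : Fin a, (if A i (x 0) = true then Real.exp (q x i) else 0) := by
          rw [Finset.mul_sum, Finset.mul_sum, ← Finset.sum_add_distrib]
          refine Finset.sum_congr rfl fun i _ => ?_
          split_ifs <;> ring
      _ = 1 := by rw [e1, e2, mul_one, mul_one, hαβ]
  have htr : ∀ x, transfer A (fun x => α * F x + β * H x) (fun y => Real.exp (w y)) x =
      Real.exp Q * Real.exp (w x) * ∑ i : Fin a, (if A i (x 0) = true then
        Real.exp (α * p x i + β * q x i) else 0) := by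
    intro x
    rw [transfer, Finset.mul_sum]
    refine Finset.sum_congr rfl fun i _ => ?_
    split_ifs
    · rw [← Real.exp_add, ← Real.exp_add, ← Real.exp_add]
      congr 1
      simp only [hw, hp, hq, hQ]
      ring
    · simp
  have hterm : ∀ x i, Real.exp (α * p x i + β * q x i) ≤
      α * Real.exp (p x i) + β * Real.exp (q x i) := fun x i =>
    convexOn_exp.2 (mem_univ _) (mem_univ _) hα.le hβ.le hαβ
  have hterm' : ∀ x, ∀ i ∈ Finset.univ,
      (if A i (x 0) = true then Real.exp (α * p x i + β * q x i) else 0) ≤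
      (if A i (x 0) = true then (α * Real.exp (p x i) + β * Real.exp (q x i)) else 0) := by
    intro x i _
    split_ifs
    · exact hterm x i
    · exact le_rfl
  obtain ⟨h1, h2⟩ := pressure_le_of_subsolution G hmix hM hwc (Q := Q) (by
    intro x hx
    rw [htr]
    refine mul_le_of_le_one_right (by positivity) ?_
    rw [← hsum1 x hx]
    exact Finset.sum_le_sum (hterm' x))
  refine ⟨h1, fun heq => ?_⟩
  have hpq : ∀ x ∈ SFT A, ∀ i, A i (x 0) = true → p x i = q x i := by
    intro x hx i hi
    have h3 := h2 heq x hx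
    rw [htr] at h3
    have h4 := mul_left_cancel₀ (by positivity) (h3.trans (mul_one _).symm)
    rw [← hsum1 x hx] at h4
    have h5 := (Finset.sum_eq_sum_iff_of_le (hterm' x)).1 h4 i (Finset.mem_univ i)
    rw [if_pos hi, if_pos hi] at h5
    by_contra hne
    have := strictConvexOn_exp.2 (mem_univ (p x i)) (mem_univ (q x i)) hne hα hβ hαβ
    simp only [smul_eq_mul] at this
    exact this.ne h5
  refine ⟨G.P H - G.P F, fun x => u x - v x, huc.sub hvc, fun y hy => ?_⟩
  have h := hpq (shift y) (shift_mem_SFT hy) (y 0) (hy 0)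
  simp only [hp, hq, cons_shift] at h
  linarith

end Pressure

section GibbsMeasure

variable {a : ℕ} {A : Fin a → Fin a → Bool} (G : GibbsData a A)

lemma integral_gibbs {F : (ℕ → Fin a) → ℝ} (hF : HolderSeq F) (h : (ℕ → Fin a) → ℝ) :
    ∫ x, h x ∂(G.μ F) = ∫ x, G.φ F x * h x ∂(G.ν F) := by
  have hm : Measurable fun x => (G.φ F x).toNNReal := (G.φ_holder F hF).1.measurable.real_toNNReal
  have hdef : G.μ F = (G.ν F).withDensity fun x => ((G.φ F x).toNNReal : ENNReal) := rfl
  rw [hdef, integral_withDensity_eq_integral_smul hm]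
  refine integral_congr_ae ((G.eigen F hF).ae_mem.mono fun x hx => ?_)
  simp only [NNReal.smul_def, smul_eq_mul, Real.coe_toNNReal _ (G.φ_pos F hF x hx).le]

lemma gibbs_ae_mem {F : (ℕ → Fin a) → ℝ} (hF : HolderSeq F) : ∀ᵐ x ∂(G.μ F), x ∈ SFT A :=
  (withDensity_absolutelyContinuous _ _).ae_le (G.eigen F hF).ae_mem

lemma gibbs_isProbabilityMeasure {F : (ℕ → Fin a) → ℝ} (hF : HolderSeq F) :
    IsProbabilityMeasure (G.μ F) := by
  have := (G.eigen F hF).1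
  refine ⟨?_⟩
  rw [GibbsData.μ, withDensity_apply _ MeasurableSet.univ, Measure.restrict_univ,
    ← ofReal_integral_eq_lintegral_ofReal
      (integrable_of_continuous _ (G.φ_holder F hF).1)
      ((G.eigen F hF).ae_mem.mono fun x hx => (G.φ_pos F hF x hx).le), G.φ_norm F hF,
    ENNReal.ofReal_one]

/-- The Gibbs measure is shift invariant. -/
lemma integral_gibbs_comp_shift {F : (ℕ → Fin a) → ℝ} (hF : HolderSeq F) {h : (ℕ → Fin a) → ℝ}
    (hh : Continuous h) : ∫ x, h (shift x) ∂(G.μ F) = ∫ x, h x ∂(G.μ F) := by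
  have he := G.eigen F hF
  have hφ := (G.φ_holder F hF).1
  rw [integral_gibbs G hF, integral_gibbs G hF]
  have h1 := he.2.2 (fun y => h (shift y) * G.φ F y) ((hh.comp continuous_shift).mul hφ)
  have h2 : ∫ x, transfer A F (fun y => h (shift y) * G.φ F y) x ∂(G.ν F) =
      Real.exp (G.P F) * ∫ x, G.φ F x * h x ∂(G.ν F) := by
    rw [← integral_const_mul]
    refine integral_congr_ae (he.ae_mem.mono fun x hx => ?_)
    simp only [transfer_comp_shift_mul, G.φ_eigen F hF x hx]
    ring
  rw [h2] at h1
  simp_rw [mul_comm (G.φ F _) (h (shift _))]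
  exact (mul_left_cancel₀ (Real.exp_pos _).ne' h1).symm

/-- Uniform convergence of integrands together with weak convergence of probability measures
gives convergence of integrals. -/
lemma tendsto_integral_of_uniform_of_weak {ι : Type*} {l : Filter ι} {E : Type*}
    [TopologicalSpace E] [CompactSpace E] [MeasurableSpace E] [OpensMeasurableSpace E]
    {κ : ι → ProbabilityMeasure E} {κ₀ : ProbabilityMeasure E} (hκ : Tendsto κ l (𝓝 κ₀))
    {k : ι → E → ℝ} {k₀ : E → ℝ} (hk : ∀ s, Continuous (k s)) (hk₀ : Continuous k₀)
    (hunif : TendstoUniformly k k₀ l) :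
    Tendsto (fun s => ∫ x, k s x ∂(κ s : Measure E)) l (𝓝 (∫ x, k₀ x ∂(κ₀ : Measure E))) := by
  have h1 := ProbabilityMeasure.tendsto_iff_forall_integral_tendsto.1 hκ
    (BoundedContinuousFunction.mkOfCompact ⟨k₀, hk₀⟩)
  have hI : ∀ (κ : ProbabilityMeasure E) {g : E → ℝ}, Continuous g →
      Integrable g (κ : Measure E) := fun κ g hg =>
    hg.integrable_of_hasCompactSupport (HasCompactSupport.of_compactSpace g)
  have h2 : Tendsto (fun s => ∫ x, k s x ∂(κ s : Measure E) - ∫ x, k₀ x ∂(κ s : Measure E))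
      l (𝓝 0) := by
    rw [Metric.tendsto_nhds]
    intro ε hε
    filter_upwards [Metric.tendstoUniformly_iff.1 hunif (ε / 2) (half_pos hε)] with s hs
    rw [dist_zero_right, ← integral_sub (hI _ (hk s)) (hI _ hk₀)]
    have : ‖∫ x, (k s x - k₀ x) ∂(κ s : Measure E)‖ ≤ ε / 2 * (κ s : Measure E).real univ := by
      refine norm_integral_le_of_norm_le_const (Eventually.of_forall fun x => ?_)
      have := hs x
      rw [dist_comm, dist_eq_norm] at this
      exact this.le
    rw [probReal_univ, mul_one] at this
    linarith
  have h3 := h2.add h1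
  simpa using h3

/-- A jointly continuous family on a compact space converges uniformly. -/
lemma tendstoUniformly_of_continuous_prod {E Y : Type*} [TopologicalSpace E] [CompactSpace E]
    [TopologicalSpace Y] {k : Y → E → ℝ} (hk : Continuous fun p : Y × E => k p.1 p.2) (y : Y) :
    TendstoUniformly k (k y) (𝓝 y) :=
  ContinuousMap.tendsto_iff_tendstoUniformly.1
    ((ContinuousMap.curry ⟨fun p : Y × E => k p.1 p.2, hk⟩).continuous.tendsto y)

lemma holderSeq_line {F g : (ℕ → Fin a) → ℝ} (hF : HolderSeq F) (hg : HolderSeq g) (s : ℝ) :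
    HolderSeq fun x => F x + s * g x :=
  hF.add (hg.const_mul s)

lemma convexOn_pressure_line (hmix : Mixing A) {F g : (ℕ → Fin a) → ℝ} (hF : HolderSeq F)
    (hg : HolderSeq g) : ConvexOn ℝ univ fun s : ℝ => G.P fun x => F x + s * g x := by
  refine convexOn_iff_forall_pos.2 ⟨convex_univ, fun s _ r _ α β hα hβ hαβ => ?_⟩
  have := (pressure_convex G hmix (holderSeq_line hF hg s) (holderSeq_line hF hg r)
    hα hβ hαβ).1
  refine le_trans (le_of_eq ?_) this
  congr 1
  funext x
  simp only [smul_eq_mul]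
  linear_combination (-F x) * hαβ

lemma continuous_pressure_line (hmix : Mixing A) {F g : (ℕ → Fin a) → ℝ} (hF : HolderSeq F)
    (hg : HolderSeq g) : Continuous fun s : ℝ => G.P fun x => F x + s * g x :=
  continuousOn_univ.1 ((convexOn_pressure_line G hmix hF hg).continuousOn isOpen_univ)

/-- The eigenmeasure bundled as a probability measure along a line of potentials. -/
noncomputable def lineEigenmeasure {F g : (ℕ → Fin a) → ℝ} (hF : HolderSeq F)
    (hg : HolderSeq g) (s : ℝ) : ProbabilityMeasure (ℕ → Fin a) :=
  ⟨G.ν fun x => F x + s * g x, (G.eigen _ (holderSeq_line hF hg s)).1⟩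

/-- Eigenmeasures depend weakly continuously on the potential along a line. -/
lemma tendsto_lineEigenmeasure (hmix : Mixing A) {F g : (ℕ → Fin a) → ℝ} (hF : HolderSeq F)
    (hg : HolderSeq g) :
    Tendsto (lineEigenmeasure G hF hg) (𝓝 0) (𝓝 ⟨G.ν F, (G.eigen F hF).1⟩) := by
  refine tendsto_nhds_of_unique_mapClusterPt fun κ hκ => ?_
  obtain ⟨U, hU, hUκ⟩ := mapClusterPt_iff_ultrafilter.1 hκ
  have heig : Eigenmeasure A F (Real.exp (G.P F)) (κ : Measure (ℕ → Fin a)) := by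
    refine ⟨inferInstance, ?_, fun k hk => ?_⟩
    · have h := ProbabilityMeasure.le_liminf_measure_open_of_tendsto hUκ
        (isClosed_SFT (A := A)).isOpen_compl
      have h0 : ∀ s, (lineEigenmeasure G hF hg s : Measure (ℕ → Fin a)) (SFT A)ᶜ = 0 :=
        fun s => (G.eigen _ (holderSeq_line hF hg s)).2.1
      simp_rw [h0] at h
      simpa using h
    · have hj : Continuous fun p : ℝ × (ℕ → Fin a) =>
          transfer A (fun x => F x + p.1 * g x) k p.2 :=
        continuous_transfer_prod (F := fun s x => F x + s * g x) (g := fun _ => k)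
          ((hF.1.comp continuous_snd).add (continuous_fst.mul (hg.1.comp continuous_snd)))
          (hk.comp continuous_snd)
      have hu : TendstoUniformly (fun s => transfer A (fun x => F x + s * g x) k)
          (transfer A F k) U := by
        have := tendstoUniformly_of_continuous_prod
          (k := fun s : ℝ => transfer A (fun x => F x + s * g x) k) hj 0
        simp only [zero_mul, add_zero] at this
        exact fun v hv => hU (this v hv)
      have h1 := tendsto_integral_of_uniform_of_weak hUκ
        (fun s => continuous_transfer (holderSeq_line hF hg s).1 hk)
        (continuous_transfer (A := A) hF.1 hk) hu
      have h2 := tendsto_integral_of_uniform_of_weak hUκ (k := fun _ => k) (fun _ => hk) hk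
        (fun v hv => Eventually.of_forall fun s x => refl_mem_uniformity hv)
      have h3 : Tendsto (fun s : ℝ => Real.exp (G.P fun x => F x + s * g x)) U
          (𝓝 (Real.exp (G.P F))) := by
        have := (Real.continuous_exp.comp (continuous_pressure_line G hmix hF hg)).tendsto 0
        simp only [Function.comp_def, zero_mul, add_zero] at this
        exact this.mono_left hU
      refine tendsto_nhds_unique h1 ((h3.mul h2).congr fun s => ?_)
      exact ((G.eigen _ (holderSeq_line hF hg s)).2.2 k hk).symm
  exact Subtype.ext (G.unique F hF _ _ heig).2

/-- The derivative of the pressure along a line is the integral against the Gibbs measure. -/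
lemma hasDerivAt_pressure_line (hmix : Mixing A) {F g : (ℕ → Fin a) → ℝ} (hF : HolderSeq F)
    (hg : HolderSeq g) :
    HasDerivAt (fun s : ℝ => G.P fun x => F x + s * g x) (∫ x, g x ∂(G.μ F)) 0 := by
  set φ := G.φ F with hφ
  have hφc : Continuous φ := (G.φ_holder F hF).1
  set q : ℝ → ℝ := dslope Real.exp 0 with hqdef
  have hqc : Continuous q := by
    rw [continuous_iff_continuousAt]
    intro b
    by_cases hb : b = 0
    · subst hb
      exact continuousAt_dslope_same.2 Real.differentiable_exp.differentiableAt
    · exact (continuousAt_dslope_of_ne hb).2 Real.continuous_exp.continuousAt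
  have hq : ∀ b, Real.exp b - 1 = b * q b := fun b => by
    have := sub_smul_dslope Real.exp 0 b
    simpa using this.symm
  set k : ℝ → (ℕ → Fin a) → ℝ := fun s x => g x * q (s * g x) * φ x with hk
  have hkc : Continuous fun p : ℝ × (ℕ → Fin a) => k p.1 p.2 :=
    ((hg.1.comp continuous_snd).mul
      (hqc.comp (continuous_fst.mul (hg.1.comp continuous_snd)))).mul (hφc.comp continuous_snd)
  have hkcs : ∀ s, Continuous (k s) := fun s => hkc.comp (continuous_const.prodMk continuous_id)
  have hTc : Continuous fun p : ℝ × (ℕ → Fin a) => transfer A F (k p.1) p.2 :=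
    continuous_transfer_prod (F := fun _ => F) (hF.1.comp continuous_snd) hkc
  have hw := tendsto_lineEigenmeasure G hmix hF hg
  set E : ℝ → ℝ := fun s => Real.exp (G.P fun x => F x + s * g x) with hE
  set κ := lineEigenmeasure G hF hg with hκ
  have hE0 : E 0 = Real.exp (G.P F) := by simp [hE]
  have hnum := tendsto_integral_of_uniform_of_weak hw
    (fun s => continuous_transfer (A := A) hF.1 (hkcs s))
    (continuous_transfer (A := A) hF.1 (hkcs 0))
    (tendstoUniformly_of_continuous_prod (k := fun s => transfer A F (k s)) hTc 0)
  have hden := tendsto_integral_of_uniform_of_weak hw (k := fun _ => φ) (fun _ => hφc) hφc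
    (fun v hv => Eventually.of_forall fun s x => refl_mem_uniformity hv)
  have hk0 : k 0 = fun x => g x * φ x := by
    funext x
    simp [hk, hqdef, dslope_same]
  have hnum0 : ∫ x, transfer A F (k 0) x ∂(G.ν F) = E 0 * ∫ x, g x ∂(G.μ F) := by
    rw [(G.eigen F hF).2.2 _ (hkcs 0), hk0, integral_gibbs G hF, hE0]
    simp_rw [mul_comm (g _)]
    rfl
  have hden0 : ∫ x, φ x ∂(G.ν F) = 1 := G.φ_norm F hF
  have hkey : ∀ s, (E s - E 0) * ∫ x, φ x ∂(κ s : Measure (ℕ → Fin a)) =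
      s * ∫ x, transfer A F (k s) x ∂(κ s : Measure (ℕ → Fin a)) := by
    intro s
    have he := G.eigen _ (holderSeq_line hF hg s)
    have h1 := he.2.2 φ hφc
    change _ * ∫ x, φ x ∂(G.ν fun x => F x + s * g x) =
      s * ∫ x, transfer A F (k s) x ∂(G.ν fun x => F x + s * g x)
    have := he.1
    rw [sub_mul, ← integral_const_mul (E 0), ← integral_const_mul s]
    simp only [hE] at h1 ⊢
    rw [← h1, ← integral_sub (integrable_of_continuous _
      (continuous_transfer (holderSeq_line hF hg s).1 hφc))
      (integrable_of_continuous _ (hφc.const_mul _))]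
    refine integral_congr_ae (he.ae_mem.mono fun x hx => ?_)
    have h2 : Real.exp (G.P fun x => F x + 0 * g x) * φ x = transfer A F φ x := by
      rw [G.φ_eigen F hF x hx]
      simp [hφ]
    simp only [h2]
    rw [transfer_add_potential F (fun y => s * g y), ← transfer_sub]
    have h3 : (fun y => Real.exp (s * g y) * φ y - φ y) =
        fun y => s * k s y := by
      funext y
      have := hq (s * g y)
      simp only [hk]
      linear_combination φ y * this
    rw [h3]
    exact transfer_comp_shift_mul F (k s) (fun _ => s) x
  have hdenpos : ∀ᶠ s in 𝓝 (0 : ℝ), 0 < ∫ x, φ x ∂(κ s : Measure (ℕ → Fin a)) := by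
    refine hden.eventually (lt_mem_nhds ?_)
    change 0 < ∫ x, φ x ∂(G.ν F)
    rw [hden0]
    exact one_pos
  have hderE : HasDerivAt E (E 0 * ∫ x, g x ∂(G.μ F)) 0 := by
    rw [hasDerivAt_iff_tendsto_slope]
    have hlim := hnum.div hden (by
      change ∫ x, φ x ∂(G.ν F) ≠ 0
      rw [hden0]
      exact one_ne_zero)
    change Tendsto _ _ (𝓝 ((∫ x, transfer A F (k 0) x ∂(G.ν F)) / ∫ x, φ x ∂(G.ν F))) at hlim
    rw [hnum0, hden0, div_one] at hlim
    refine (hlim.mono_left nhdsWithin_le_nhds).congr' ?_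
    filter_upwards [self_mem_nhdsWithin, nhdsWithin_le_nhds hdenpos] with s hs hpos
    rw [slope_def_field, sub_zero]
    have hs' : s ≠ 0 := hs
    simp only [Pi.div_apply]
    rw [div_eq_div_iff hpos.ne' hs']
    linear_combination -hkey s
  have hlog := hderE.log (by rw [hE0]; exact (Real.exp_pos _).ne')
  simp only [hE, Real.log_exp] at hlog
  convert hlog using 1
  rw [mul_div_cancel_left₀ _ (Real.exp_pos _).ne']

end GibbsMeasure

section Concentration

variable {a : ℕ} {A : Fin a → Fin a → Bool} (G : GibbsData a A)

lemma integral_exp_birkhoff_mul_eigenfunction {F K : (ℕ → Fin a) → ℝ} (hF : HolderSeq F)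
    (hK : HolderSeq K) (n : ℕ) :
    ∫ x, Real.exp (birkhoff n K x) * G.φ (fun y => F y + K y) x ∂(G.ν F) =
      Real.exp (n * (G.P (fun y => F y + K y) - G.P F)) *
        ∫ x, G.φ (fun y => F y + K y) x ∂(G.ν F) := by
  have hFK : HolderSeq fun y => F y + K y := hF.add hK
  have he := G.eigen F hF
  set φ := G.φ fun y => F y + K y with hφ
  have hφc : Continuous φ := (G.φ_holder _ hFK).1
  induction n with
  | zero => simp [birkhoff]
  | succ n ih =>
    have hB := Real.continuous_exp.comp (continuous_birkhoff hK.1 n)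
    set h : (ℕ → Fin a) → ℝ :=
      fun y => Real.exp (birkhoff n K (shift y)) * (Real.exp (K y) * φ y) with hh
    have hhc : Continuous h := (hB.comp continuous_shift).mul
      ((Real.continuous_exp.comp hK.1).mul hφc)
    have e1 : ∫ x, Real.exp (birkhoff (n + 1) K x) * φ x ∂(G.ν F) = ∫ x, h x ∂(G.ν F) := by
      congr 1
      funext x
      rw [birkhoff_succ, Real.exp_add]
      simp only [hh]
      ring
    have e2 : ∫ x, transfer A F h x ∂(G.ν F) = Real.exp (G.P fun y => F y + K y) *
        ∫ x, Real.exp (birkhoff n K x) * φ x ∂(G.ν F) := by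
      rw [← integral_const_mul]
      refine integral_congr_ae (he.ae_mem.mono fun x hx => ?_)
      simp only [hh]
      rw [transfer_comp_shift_mul F (fun y => Real.exp (K y) * φ y)
        (fun y => Real.exp (birkhoff n K y)), ← transfer_add_potential, G.φ_eigen _ hFK x hx]
      ring
    rw [he.2.2 h hhc, ih, ← mul_assoc, ← Real.exp_add] at e2
    rw [e1]
    apply mul_left_cancel₀ (Real.exp_pos (G.P F)).ne'
    rw [e2, ← mul_assoc, ← Real.exp_add]
    congr 2
    push_cast
    ring

/-- Exponential moments of Birkhoff sums grow at most like the pressure difference. -/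
lemma integral_exp_birkhoff_le {F K : (ℕ → Fin a) → ℝ} (hF : HolderSeq F) (hK : HolderSeq K) :
    ∃ C : ℝ, ∀ n : ℕ, ∫ x, Real.exp (birkhoff n K x) ∂(G.μ F) ≤
      C * Real.exp (G.P (fun y => F y + K y) - G.P F) ^ n := by
  have hFK : HolderSeq fun y => F y + K y := hF.add hK
  have he := G.eigen F hF
  have := he.1
  obtain ⟨u, huc, hu⟩ := exists_log_eigenfunction G hF
  obtain ⟨v, hvc, hv⟩ := exists_log_eigenfunction G hFK
  set φ := G.φ fun y => F y + K y with hφ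
  have hφc : Continuous φ := (G.φ_holder _ hFK).1
  obtain ⟨C, hC⟩ := isCompact_univ.exists_bound_of_continuousOn
    ((Real.continuous_exp.comp (huc.sub hvc)).continuousOn (s := univ))
  refine ⟨C * ∫ x, φ x ∂(G.ν F), fun n => ?_⟩
  have hB := Real.continuous_exp.comp (continuous_birkhoff hK.1 n)
  rw [integral_gibbs G hF, ← Real.exp_nat_mul]
  calc ∫ x, G.φ F x * Real.exp (birkhoff n K x) ∂(G.ν F)
      ≤ ∫ x, C * (Real.exp (birkhoff n K x) * φ x) ∂(G.ν F) := by
        refine integral_mono_ae (integrable_of_continuous _ ((G.φ_holder F hF).1.mul hB))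
          (integrable_of_continuous _ ((hB.mul hφc).const_mul C)) (he.ae_mem.mono fun x hx => ?_)
        have h1 : Real.exp (u x - v x) ≤ C := (le_abs_self _).trans (hC x (mem_univ x))
        have h2 : G.φ F x ≤ C * φ x := by
          rw [← hu x hx, ← hv x hx, ← div_le_iff₀ (Real.exp_pos _), ← Real.exp_sub]
          exact h1
        have := mul_le_mul_of_nonneg_right h2 (Real.exp_pos (birkhoff n K x)).le
        simp only
        linarith
    _ = _ := by
        rw [integral_const_mul, integral_exp_birkhoff_mul_eigenfunction G hF hK n]
        ring

lemma birkhoff_const_mul (n : ℕ) (c : ℝ) (h : (ℕ → Fin a) → ℝ) (x : ℕ → Fin a) :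
    birkhoff n (fun y => c * h y) x = c * birkhoff n h x := by
  simp [birkhoff, Finset.mul_sum]

/-- Almost sure upper bound for Birkhoff averages under a Gibbs measure. -/
lemma ae_eventually_birkhoff_lt (hmix : Mixing A) {F g : (ℕ → Fin a) → ℝ} (hF : HolderSeq F)
    (hg : HolderSeq g) {ε : ℝ} (hε : 0 < ε) :
    ∀ᵐ x ∂(G.μ F), ∀ᶠ n : ℕ in atTop,
      birkhoff n g x < n * (∫ y, g y ∂(G.μ F) + ε) := by
  have := gibbs_isProbabilityMeasure G hF
  set D := ∫ y, g y ∂(G.μ F) with hD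
  obtain ⟨s, hs0, hs⟩ : ∃ s : ℝ, 0 < s ∧
      (G.P fun x => F x + s * g x) - G.P F < s * (D + ε) := by
    have h := (hasDerivAt_iff_tendsto_slope.1 (hasDerivAt_pressure_line G hmix hF hg)).mono_left
      (nhdsWithin_mono 0 (fun s (hs : s ∈ Ioi (0 : ℝ)) => (ne_of_gt hs : s ≠ 0)))
    obtain ⟨s, hs1, hs2⟩ := ((h.eventually (gt_mem_nhds (lt_add_of_pos_right D hε))).and
      self_mem_nhdsWithin).exists
    have hs2 : 0 < s := hs2
    refine ⟨s, hs2, ?_⟩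
    rw [slope_def_field, sub_zero, div_lt_iff₀ hs2] at hs1
    simp only [zero_mul, add_zero] at hs1
    linarith
  obtain ⟨C, hC⟩ := integral_exp_birkhoff_le G hF (hg.const_mul s)
  set r := Real.exp ((G.P fun x => F x + s * g x) - G.P F - s * (D + ε)) with hr
  have hr1 : r < 1 := Real.exp_lt_one_iff.2 (by linarith)
  have hr0 : 0 < r := Real.exp_pos _
  set B : ℕ → Set (ℕ → Fin a) := fun n => {x | n * (D + ε) ≤ birkhoff n g x} with hB
  have hbound : ∀ n, (G.μ F).real (B n) ≤ C * r ^ n := by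
    intro n
    have hc : Continuous fun x => Real.exp (birkhoff n (fun y => s * g y) x) :=
      Real.continuous_exp.comp (continuous_birkhoff (hg.const_mul s).1 n)
    have hmk := mul_meas_ge_le_integral_of_nonneg (μ := G.μ F)
      (Eventually.of_forall fun x => (Real.exp_pos (birkhoff n (fun y => s * g y) x)).le)
      (integrable_of_continuous _ hc) (Real.exp (s * (D + ε)) ^ n)
    have hset : {x | Real.exp (s * (D + ε)) ^ n ≤ Real.exp (birkhoff n (fun y => s * g y) x)} =
        B n := by
      ext x
      simp only [hB, mem_ofPred_eq]
      rw [birkhoff_const_mul, ← Real.exp_nat_mul, Real.exp_le_exp,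
        show (n : ℝ) * (s * (D + ε)) = s * (n * (D + ε)) by ring]
      exact mul_le_mul_iff_right₀ hs0
    rw [hset] at hmk
    have h1 := hmk.trans (hC n)
    have h2 : Real.exp ((G.P fun x => F x + s * g x) - G.P F) = r * Real.exp (s * (D + ε)) := by
      rw [hr, ← Real.exp_add]
      congr 1
      ring
    rw [h2, mul_pow, ← mul_assoc, mul_comm] at h1
    exact le_of_mul_le_mul_right h1 (by positivity)
  have hsum : ∑' n, G.μ F (B n) ≠ ⊤ := by
    have hS : Summable fun n => C * r ^ n := (summable_geometric_of_lt_one hr0.le hr1).mul_left C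
    have hle : ∀ n, G.μ F (B n) ≤ ENNReal.ofReal (C * r ^ n) := by
      intro n
      rw [← ofReal_measureReal]
      exact ENNReal.ofReal_le_ofReal (hbound n)
    refine ne_top_of_le_ne_top ?_ (ENNReal.tsum_le_tsum hle)
    rw [← ENNReal.ofReal_tsum_of_nonneg (fun n => measureReal_nonneg.trans (hbound n)) hS]
    exact ENNReal.ofReal_ne_top
  filter_upwards [ae_eventually_notMem hsum] with x hx
  filter_upwards [hx] with n hn
  exact not_le.1 hn

/-- The strong law of large numbers for Birkhoff averages under a Gibbs measure. -/
lemma ae_tendsto_birkhoff_average (hmix : Mixing A) {F g : (ℕ → Fin a) → ℝ} (hF : HolderSeq F)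
    (hg : HolderSeq g) :
    ∀ᵐ x ∂(G.μ F), Tendsto (fun n : ℕ => 1 / (n : ℝ) * birkhoff n g x) atTop
      (𝓝 (∫ y, g y ∂(G.μ F))) := by
  have hup := ae_all_iff.2 fun k : ℕ =>
    ae_eventually_birkhoff_lt G hmix hF hg (Nat.one_div_pos_of_nat (n := k) (α := ℝ))
  have hlo := ae_all_iff.2 fun k : ℕ =>
    ae_eventually_birkhoff_lt G hmix hF (hg.const_mul (-1))
      (Nat.one_div_pos_of_nat (n := k) (α := ℝ))
  filter_upwards [hup, hlo] with x h1 h2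
  rw [Metric.tendsto_nhds]
  intro ε hε
  obtain ⟨k, hk⟩ := exists_nat_one_div_lt hε
  filter_upwards [h1 k, h2 k, eventually_gt_atTop 0] with n hn1 hn2 hn
  have hn' : (0 : ℝ) < n := Nat.cast_pos.2 hn
  rw [birkhoff_const_mul, integral_const_mul] at hn2
  rw [Real.dist_eq, abs_lt]
  have e : (n : ℝ) * (1 / (n : ℝ) * birkhoff n g x) = birkhoff n g x := by field_simp
  constructor
  · by_contra! hcon
    have := mul_le_mul_of_nonneg_left hcon hn'.le
    nlinarith
  · by_contra! hcon
    have := mul_le_mul_of_nonneg_left hcon hn'.le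
    nlinarith

/-- Bounded distortion: suprema over cylinders differ from Birkhoff sums by a bounded amount. -/
lemma exists_abs_supCyl_sub_birkhoff_le {g : (ℕ → Fin a) → ℝ} (hg : HolderSeq g) :
    ∃ K : ℝ, ∀ x ∈ SFT A, ∀ n, |supCyl A n g x - birkhoff n g x| ≤ K := by
  obtain ⟨hgc, C, ρ, hρ0, hρ1, hC⟩ := hg
  refine ⟨|C| * (1 - ρ)⁻¹, fun x hx n => ?_⟩
  have hdist : ∀ y ∈ cyl A n x, birkhoff n g y - birkhoff n g x ≤ |C| * (1 - ρ)⁻¹ := by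
    intro y hy
    have h1 : ∀ k ∈ Finset.range n, g (shift^[k] y) - g (shift^[k] x) ≤ |C| * ρ ^ (n - 1 - k) := by
      intro k hk
      have hk' := Finset.mem_range.1 hk
      refine (le_abs_self _).trans ((hC (n - 1 - k) _ _ fun i hi => ?_).trans
        (mul_le_mul_of_nonneg_right (le_abs_self C) (pow_nonneg hρ0.le _)))
      rw [shift_iterate_apply, shift_iterate_apply]
      exact hy.2 _ (by omega)
    calc birkhoff n g y - birkhoff n g x
        = ∑ k ∈ Finset.range n, (g (shift^[k] y) - g (shift^[k] x)) := by
          rw [birkhoff, birkhoff, Finset.sum_sub_distrib]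
      _ ≤ ∑ k ∈ Finset.range n, |C| * ρ ^ (n - 1 - k) := Finset.sum_le_sum h1
      _ = |C| * ∑ k ∈ Finset.range n, ρ ^ k := by
          rw [Finset.sum_range_reflect (fun k => |C| * ρ ^ k) n, Finset.mul_sum]
      _ ≤ |C| * (1 - ρ)⁻¹ := by
          refine mul_le_mul_of_nonneg_left ?_ (abs_nonneg C)
          rw [← tsum_geometric_of_lt_one hρ0.le hρ1]
          exact (summable_geometric_of_lt_one hρ0.le hρ1).sum_le_tsum _
            fun i _ => pow_nonneg hρ0.le i
  have hxm : birkhoff n g x ∈ birkhoff n g '' cyl A n x :=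
    mem_image_of_mem _ ⟨hx, fun _ _ => rfl⟩
  have hup : ∀ b ∈ birkhoff n g '' cyl A n x, b ≤ birkhoff n g x + |C| * (1 - ρ)⁻¹ := by
    rintro _ ⟨y, hy, rfl⟩
    linarith [hdist y hy]
  have h1 : birkhoff n g x ≤ supCyl A n g x := le_csSup ⟨_, hup⟩ hxm
  have h2 : supCyl A n g x ≤ birkhoff n g x + |C| * (1 - ρ)⁻¹ := csSup_le ⟨_, hxm⟩ hup
  rw [abs_le]
  constructor
  · have := h1.trans h2
    linarith
  · linarith

lemma ae_tendsto_supCyl_average (hmix : Mixing A) {F g : (ℕ → Fin a) → ℝ} (hF : HolderSeq F)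
    (hg : HolderSeq g) :
    ∀ᵐ x ∂(G.μ F), Tendsto (fun n : ℕ => 1 / (n : ℝ) * supCyl A n g x) atTop
      (𝓝 (∫ y, g y ∂(G.μ F))) := by
  obtain ⟨K, hK⟩ := exists_abs_supCyl_sub_birkhoff_le (A := A) hg
  filter_upwards [ae_tendsto_birkhoff_average G hmix hF hg, gibbs_ae_mem G hF] with x hx hxm
  have h0 : Tendsto (fun n : ℕ => 1 / (n : ℝ) * (supCyl A n g x - birkhoff n g x)) atTop
      (𝓝 0) := by
    refine squeeze_zero_norm (a := fun n : ℕ => 1 / (n : ℝ) * K) (fun n => ?_) ?_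
    · rw [norm_mul, Real.norm_of_nonneg (by positivity)]
      exact mul_le_mul_of_nonneg_left (hK x hxm n) (by positivity)
    · simpa using (tendsto_one_div_atTop_nhds_zero_nat (𝕜 := ℝ)).mul_const K
  have := h0.add hx
  rw [zero_add] at this
  exact this.congr fun n => by ring

end Concentration

section Covariance

variable {a d : ℕ} {A : Fin a → Fin a → Bool} (G : GibbsData a A)

/-- The quadratic form of an asymptotic covariance matrix is the asymptotic variance of the
corresponding linear combination. -/
lemma tendsto_variance_combination {μ : Measure (ℕ → Fin a)} [IsProbabilityMeasure μ]
    {f : Fin d → (ℕ → Fin a) → ℝ} (hf : ∀ i, Continuous (f i)) {S : Matrix (Fin d) (Fin d) ℝ}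
    (hS : ∀ i j, Covμ μ (f i) (f j) (S i j)) (v : Fin d → ℝ) :
    Tendsto (fun m : ℕ => 1 / (m : ℝ) *
      ∫ x, (∑ i, v i * birkhoff m (fun y => f i y - ∫ z, f i z ∂μ) x) ^ 2 ∂μ) atTop
      (𝓝 (v ⬝ᵥ S.mulVec v)) := by
  have h : Tendsto (fun m : ℕ => ∑ i, ∑ j, v i * v j * (1 / (m : ℝ) *
      ∫ x, birkhoff m (fun y => f i y - ∫ z, f i z ∂μ) x *
        birkhoff m (fun y => f j y - ∫ z, f j z ∂μ) x ∂μ)) atTop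
      (𝓝 (∑ i, ∑ j, v i * v j * S i j)) :=
    tendsto_finsetSum _ fun i _ => tendsto_finsetSum _ fun j _ => (hS i j).const_mul _
  have e : v ⬝ᵥ S.mulVec v = ∑ i, ∑ j, v i * v j * S i j := by
    simp only [dotProduct, Matrix.mulVec, Finset.mul_sum]
    exact Finset.sum_congr rfl fun i _ => Finset.sum_congr rfl fun j _ => by ring
  rw [e]
  refine h.congr fun m => ?_
  have hb : ∀ i, Continuous (birkhoff m fun y => f i y - ∫ z, f i z ∂μ) := fun i =>
    continuous_birkhoff ((hf i).sub continuous_const) m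
  have hI : ∀ i j, Integrable (fun x => v i * v j *
      (birkhoff m (fun y => f i y - ∫ z, f i z ∂μ) x *
        birkhoff m (fun y => f j y - ∫ z, f j z ∂μ) x)) μ := fun i j =>
    integrable_of_continuous μ (((hb i).mul (hb j)).const_mul _)
  have e2 : ∀ x, (∑ i, v i * birkhoff m (fun y => f i y - ∫ z, f i z ∂μ) x) ^ 2 =
      ∑ i, ∑ j, v i * v j * (birkhoff m (fun y => f i y - ∫ z, f i z ∂μ) x *
        birkhoff m (fun y => f j y - ∫ z, f j z ∂μ) x) := by
    intro x
    rw [sq, Finset.sum_mul_sum]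
    exact Finset.sum_congr rfl fun i _ => Finset.sum_congr rfl fun j _ => by ring
  simp_rw [e2]
  rw [integral_finsetSum _ fun i _ => integrable_finsetSum _ fun j _ => hI i j, Finset.mul_sum]
  refine Finset.sum_congr rfl fun i _ => ?_
  rw [integral_finsetSum _ fun j _ => hI i j, Finset.mul_sum]
  refine Finset.sum_congr rfl fun j _ => ?_
  rw [integral_const_mul]
  ring

lemma posDef_covariance {μ : Measure (ℕ → Fin a)} [IsProbabilityMeasure μ]
    {f : Fin d → (ℕ → Fin a) → ℝ} (hf : ∀ i, Continuous (f i)) {S : Matrix (Fin d) (Fin d) ℝ}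
    (hS : ∀ i j, Covμ μ (f i) (f j) (S i j)) (hrank : IsUnit S.det) : S.PosDef := by
  have hsymm : S.IsHermitian := by
    ext i j
    refine tendsto_nhds_unique (hS j i) ((hS i j).congr fun m => ?_)
    simp_rw [mul_comm (birkhoff m (fun y => f j y - ∫ z, f j z ∂μ) _)]
  have hpsd : S.PosSemidef := by
    refine Matrix.PosSemidef.of_dotProduct_mulVec_nonneg hsymm fun v => ?_
    rw [star_trivial]
    refine ge_of_tendsto' (tendsto_variance_combination hf hS v) fun m => ?_
    exact mul_nonneg (by positivity) (integral_nonneg fun x => sq_nonneg _)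
  exact hpsd.posDef_iff_isUnit.2 ((Matrix.isUnit_iff_isUnit_det S).2 hrank)

lemma birkhoff_sub_shift (n : ℕ) (h : (ℕ → Fin a) → ℝ) (x : ℕ → Fin a) :
    birkhoff n (fun y => h y - h (shift y)) x = h x - h (shift^[n] x) := by
  simp only [birkhoff]
  simp_rw [← Function.iterate_succ_apply' shift]
  exact Finset.sum_range_sub' (fun k => h (shift^[k] x)) n

/-- If the asymptotic covariance matrix of a Gibbs measure is invertible, then the functions are
linearly independent as cohomology classes. -/
lemma linIndepCohom_of_covariance {F : (ℕ → Fin a) → ℝ} (hF : HolderSeq F)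
    {f : Fin d → (ℕ → Fin a) → ℝ} (hf : ∀ i, HolderSeq (f i)) {S : Matrix (Fin d) (Fin d) ℝ}
    (hS : ∀ i j, Covμ (G.μ F) (f i) (f j) (S i j)) (hrank : IsUnit S.det) :
    LinIndepCohom A f := by
  rintro v ⟨c, h, hh, hcoh⟩
  have := gibbs_isProbabilityMeasure G hF
  by_contra hv
  have hpos := (posDef_covariance (fun i => (hf i).1) hS hrank).dotProduct_mulVec_pos hv
  rw [star_trivial] at hpos
  refine hpos.ne (tendsto_nhds_unique ?_
    (tendsto_variance_combination (fun i => (hf i).1) hS v))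
  have hc : ∑ i, v i * ∫ z, f i z ∂(G.μ F) = c := by
    have e1 : ∑ i, v i * ∫ z, f i z ∂(G.μ F) = ∫ z, ∑ i, v i * f i z ∂(G.μ F) := by
      rw [integral_finsetSum _ fun i _ => integrable_of_continuous _ ((hf i).1.const_mul _)]
      simp_rw [integral_const_mul]
    have e2 : ∫ z, ∑ i, v i * f i z ∂(G.μ F) = ∫ z, (c + (h z - h (shift z))) ∂(G.μ F) := by
      refine integral_congr_ae ((gibbs_ae_mem G hF).mono fun x hx => ?_)
      have := hcoh x hx
      simp only at this ⊢
      linarith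
    have hI1 := integrable_of_continuous (G.μ F) hh
    have hI2 : Integrable (fun z => h (shift z)) (G.μ F) :=
      integrable_of_continuous _ (hh.comp continuous_shift)
    have hI3 : Integrable (fun z => h z - h (shift z)) (G.μ F) := hI1.sub hI2
    have hinv : ∫ z, h (shift z) ∂(G.μ F) = ∫ z, h z ∂(G.μ F) :=
      integral_gibbs_comp_shift G hF hh
    rw [e1, e2, integral_add (integrable_const c) hI3, integral_sub hI1 hI2, hinv]
    simp
  obtain ⟨M, hM⟩ := isCompact_univ.exists_bound_of_continuousOn (hh.continuousOn (s := univ))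
  refine squeeze_zero_norm (a := fun m : ℕ => 1 / (m : ℝ) * (2 * M) ^ 2) (fun m => ?_) ?_
  · rw [norm_mul, Real.norm_of_nonneg (by positivity)]
    refine mul_le_mul_of_nonneg_left ?_ (by positivity)
    have hb : ‖∫ x, (∑ i, v i * birkhoff m (fun y => f i y - ∫ z, f i z ∂(G.μ F)) x) ^ 2
        ∂(G.μ F)‖ ≤ (2 * M) ^ 2 * (G.μ F).real univ := by
      refine norm_integral_le_of_norm_le_const ((gibbs_ae_mem G hF).mono fun x hx => ?_)
      have e3 : ∑ i, v i * birkhoff m (fun y => f i y - ∫ z, f i z ∂(G.μ F)) x =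
          h x - h (shift^[m] x) := by
        rw [← birkhoff_sub_shift]
        simp only [birkhoff, Finset.mul_sum]
        rw [Finset.sum_comm]
        refine Finset.sum_congr rfl fun k _ => ?_
        have := hcoh _ (shift_iterate_mem_SFT hx k)
        simp only [mul_sub, Finset.sum_sub_distrib, hc] at this ⊢
        linarith
      rw [e3, norm_pow]
      refine pow_le_pow_left₀ (norm_nonneg _) ?_ 2
      calc ‖h x - h (shift^[m] x)‖ ≤ ‖h x‖ + ‖h (shift^[m] x)‖ := norm_sub_le _ _
        _ ≤ 2 * M := by linarith [hM x (mem_univ _), hM (shift^[m] x) (mem_univ _)]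
    simpa using hb
  · simpa using (tendsto_one_div_atTop_nhds_zero_nat (𝕜 := ℝ)).mul_const ((2 * M) ^ 2)

/-- Under cohomological independence the pressure is strictly convex in the parameters. -/
lemma strictConvexOn_pressure (hmix : Mixing A) {f₀ : (ℕ → Fin a) → ℝ}
    {f : Fin d → (ℕ → Fin a) → ℝ} (hf₀ : HolderSeq f₀) (hf : ∀ i, HolderSeq (f i))
    (hind : LinIndepCohom A f) :
    StrictConvexOn ℝ univ fun t : Fin d → ℝ => G.P (Fpot f₀ f t) := by
  refine ⟨convex_univ, fun t _ s _ hts α β hα hβ hαβ => ?_⟩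
  obtain ⟨hle, heq⟩ := pressure_convex G hmix (holderSeq_Fpot hf₀ hf t)
    (holderSeq_Fpot hf₀ hf s) hα hβ hαβ
  have e : Fpot f₀ f (α • t + β • s) = fun x => α * Fpot f₀ f t x + β * Fpot f₀ f s x := by
    funext x
    simp only [Fpot, Pi.add_apply, Pi.smul_apply, smul_eq_mul, add_mul, Finset.sum_add_distrib,
      mul_add, Finset.mul_sum, mul_assoc]
    linear_combination (-f₀ x) * hαβ
  simp only [smul_eq_mul, e]
  refine lt_of_le_of_ne hle fun h => hts ?_
  obtain ⟨c, k, hk, hcoh⟩ := heq h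
  refine (sub_eq_zero.1 (hind (s - t) ⟨c, k, hk, fun x hx => ?_⟩)).symm
  rw [← hcoh x hx]
  simp only [Fpot, Pi.sub_apply, sub_mul, Finset.sum_sub_distrib]
  ring

end Covariance

section Maximizers

/-- Linear perturbations of a strictly concave function whose slopes converge to a supergradient
at `θ` eventually have unique maximizers, and these converge to `θ`. -/
lemma exists_maximizers_tendsto {d : ℕ} {p : (Fin d → ℝ) → ℝ} (hp : StrictConvexOn ℝ univ p)
    {D θ : Fin d → ℝ} (hD : ∀ t, p θ + ∑ i, D i * (t i - θ i) ≤ p t)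
    {α : ℕ → Fin d → ℝ} (hα : ∀ i, Tendsto (fun n => α n i) atTop (𝓝 (D i))) :
    ∃ θt : ℕ → Fin d → ℝ,
      (∀ᶠ n in atTop,
        (∀ t, ∑ i, α n i * t i - p t ≤ ∑ i, α n i * θt n i - p (θt n)) ∧
        ∀ t, (∀ t', ∑ i, α n i * t' i - p t' ≤ ∑ i, α n i * t i - p t) → t = θt n) ∧
      Tendsto θt atTop (𝓝 θ) := by
  classical
  have hpc : Continuous p := continuousOn_univ.1 (hp.convexOn.continuousOn isOpen_univ)
  set h : (Fin d → ℝ) → (Fin d → ℝ) → ℝ := fun b t => ∑ i, b i * t i - p t with hh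
  have hlin : ∀ b : Fin d → ℝ, ConcaveOn ℝ univ fun t : Fin d → ℝ => ∑ i, b i * t i := by
    intro b
    refine ⟨convex_univ, fun x _ y _ r s _ _ _ => le_of_eq ?_⟩
    simp only [smul_eq_mul, Pi.add_apply, Pi.smul_apply, mul_add, Finset.sum_add_distrib,
      Finset.mul_sum]
    congr 1 <;> exact Finset.sum_congr rfl fun i _ => by ring
  have hconc : ∀ b, StrictConcaveOn ℝ univ (h b) := fun b => by
    have e : h b = (fun t => ∑ i, b i * t i) + -p := by
      funext t
      simp [hh, sub_eq_add_neg]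
    rw [e]
    exact (hlin b).add_strictConcaveOn hp.neg
  have hcont : Continuous fun q : (Fin d → ℝ) × (Fin d → ℝ) => h q.1 q.2 :=
    (continuous_finsetSum _ fun i _ => ((continuous_apply i).comp continuous_fst).mul
      ((continuous_apply i).comp continuous_snd)).sub (hpc.comp continuous_snd)
  have hαD : Tendsto α atTop (𝓝 D) := tendsto_pi_nhds.2 hα
  have hmaxD : ∀ t, h D t ≤ h D θ := by
    intro t
    have := hD t
    simp only [mul_sub, Finset.sum_sub_distrib] at this
    simp only [hh]
    linarith
  have hltD : ∀ t, t ≠ θ → h D t < h D θ := by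
    intro t ht
    refine lt_of_le_of_ne (hmaxD t) fun he => ht ?_
    exact (hconc D).eq_of_isMaxOn (fun s _ => (hmaxD s).trans he.ge) (fun s _ => hmaxD s)
      (mem_univ _) (mem_univ _)
  have hsphere : ∀ δ > 0, ∀ᶠ n in atTop, ∀ t, δ ≤ dist t θ → h (α n) t < h (α n) θ := by
    intro δ hδ
    have hU : ∀ᶠ b in 𝓝 D, ∀ t ∈ Metric.sphere θ δ, h b t < h b θ := by
      refine (isCompact_sphere θ δ).eventually_forall_of_forall_eventually fun t ht => ?_
      have hne : t ≠ θ := by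
        rintro rfl
        rw [Metric.mem_sphere, dist_self] at ht
        exact hδ.ne ht
      have hc1 : Continuous fun q : (Fin d → ℝ) × (Fin d → ℝ) => h q.1 θ :=
        hcont.comp (continuous_fst.prodMk continuous_const)
      exact hcont.continuousAt.eventually_lt hc1.continuousAt (hltD t hne)
    filter_upwards [hαD.eventually hU] with n hn t ht
    by_contra! hcon
    have hdpos : 0 < dist t θ := hδ.trans_le ht
    set r := δ / dist t θ with hr
    have hr0 : 0 < r := div_pos hδ hdpos
    have hr1 : r ≤ 1 := (div_le_one hdpos).2 ht
    have hmem : r • t + (1 - r) • θ ∈ Metric.sphere θ δ := by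
      rw [Metric.mem_sphere, dist_eq_norm]
      have : r • t + (1 - r) • θ - θ = r • (t - θ) := by
        module
      rw [this, norm_smul, Real.norm_of_nonneg hr0.le, ← dist_eq_norm, hr,
        div_mul_cancel₀ _ hdpos.ne']
    have h1 := (hconc (α n)).concaveOn.2 (mem_univ t) (mem_univ θ) hr0.le
      (sub_nonneg.2 hr1) (by ring : r + (1 - r) = 1)
    have h2 := hn _ hmem
    simp only [smul_eq_mul] at h1
    nlinarith
  have hex : ∀ᶠ n in atTop, ∃ s, ∀ t, h (α n) t ≤ h (α n) s := by
    filter_upwards [hsphere 1 one_pos] with n hn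
    obtain ⟨s, -, hs⟩ := (isCompact_closedBall θ 1).exists_isMaxOn
      ⟨θ, Metric.mem_closedBall_self zero_le_one⟩
      (hcont.comp (continuous_const.prodMk continuous_id) (g := fun q => h q.1 q.2)
        (f := fun t => (α n, t))).continuousOn
    refine ⟨s, fun t => ?_⟩
    rcases le_total (dist t θ) 1 with ht | ht
    · exact hs ht
    · exact (hn t ht).le.trans (hs (Metric.mem_closedBall_self zero_le_one))
  refine ⟨fun n => if hn : ∃ s, ∀ t, h (α n) t ≤ h (α n) s then hn.choose else θ, ?_, ?_⟩
  · filter_upwards [hex] with n hn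
    rw [dif_pos hn]
    refine ⟨hn.choose_spec, fun t ht => ?_⟩
    exact (hconc (α n)).eq_of_isMaxOn (fun s _ => ht s) (fun s _ => hn.choose_spec s)
      (mem_univ _) (mem_univ _)
  · rw [Metric.tendsto_nhds]
    intro δ hδ
    filter_upwards [hex, hsphere δ hδ] with n hn hn'
    rw [dif_pos hn]
    by_contra! hcon
    exact (hn' _ hcon).not_ge (hn.choose_spec θ)

end Maximizers

section Subgradient

variable {a d : ℕ} {A : Fin a → Fin a → Bool} (G : GibbsData a A)

/-- The vector of Gibbs averages is a subgradient of the pressure. -/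
lemma pressure_ge_tangent (hmix : Mixing A) {f₀ : (ℕ → Fin a) → ℝ}
    {f : Fin d → (ℕ → Fin a) → ℝ} (hf₀ : HolderSeq f₀) (hf : ∀ i, HolderSeq (f i))
    (θ t : Fin d → ℝ) :
    G.P (Fpot f₀ f θ) + ∑ i, (∫ x, f i x ∂(G.μ (Fpot f₀ f θ))) * (t i - θ i) ≤
      G.P (Fpot f₀ f t) := by
  have hF := holderSeq_Fpot hf₀ hf θ
  have := gibbs_isProbabilityMeasure G hF
  have hg := holderSeq_combination hf (t - θ)
  have h := (convexOn_pressure_line G hmix hF hg).le_slope_of_hasDerivAt (mem_univ 0)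
    (mem_univ 1) one_pos (hasDerivAt_pressure_line G hmix hF hg)
  rw [slope_def_field, integral_finsetSum _ fun i _ =>
    integrable_of_continuous _ ((hf i).1.const_mul _)] at h
  have e : (fun x => Fpot f₀ f θ x + 1 * ∑ i, (t - θ) i * f i x) = Fpot f₀ f t := by
    funext x
    simp only [Fpot, Pi.sub_apply, sub_mul, Finset.sum_sub_distrib]
    ring
  rw [e] at h
  simp only [zero_mul, add_zero, sub_zero, div_one, integral_const_mul, Pi.sub_apply] at h
  simp_rw [mul_comm (∫ x, f _ x ∂_)]
  linarith

end Subgradient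

end Proof

/-- **Theorem 2.7.** Fix `θ₀ ∈ Θ` and suppose the asymptotic covariance matrix
`Σ^{μ_{θ₀}}` of `(f₁,…,f_d)` has full rank.  If the coordinate process is distributed
according to `μ_{θ₀}`, then almost surely, for all sufficiently large `n` the function
`t ↦ ⟨α_n,(1,t)⟩ − P(F_t)` attains a unique global maximum at some `θ̃_n ∈ ℝ^d`, and
`θ̃_n → θ₀` almost surely. -/
theorem theorem_2_7_maximum_potential_estimator
    {a d : ℕ} (ha : 2 ≤ a) (A : Fin a → Fin a → Bool) (hmix : Mixing A)
    (G : GibbsData a A)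
    (f₀ : (ℕ → Fin a) → ℝ) (f : Fin d → (ℕ → Fin a) → ℝ)
    (hf₀ : HolderSeq f₀) (hf : ∀ i, HolderSeq (f i))
    (Θ : Set (Fin d → ℝ)) (hΘopen : IsOpen Θ)
    (θ₀ : Fin d → ℝ) (hθ₀ : θ₀ ∈ Θ)
    (S : Matrix (Fin d) (Fin d) ℝ)
    (hS : ∀ i j : Fin d, Covμ (G.μ (Fpot f₀ f θ₀)) (f i) (f j) (S i j))
    (hrank : IsUnit S.det) :
    ∀ᵐ x ∂(G.μ (Fpot f₀ f θ₀)),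
      ∃ θt : ℕ → (Fin d → ℝ),
        (∀ᶠ n in atTop,
          (∀ t : Fin d → ℝ, MPEobjective A G f₀ f n x t ≤ MPEobjective A G f₀ f n x (θt n)) ∧
          (∀ t : Fin d → ℝ,
            (∀ t' : Fin d → ℝ, MPEobjective A G f₀ f n x t' ≤ MPEobjective A G f₀ f n x t) →
              t = θt n)) ∧
        Tendsto θt atTop (nhds θ₀) := by
  have hF := holderSeq_Fpot hf₀ hf θ₀
  have hconv := strictConvexOn_pressure G hmix hf₀ hf
    (linIndepCohom_of_covariance G hF hf hS hrank)
  filter_upwards [ae_all_iff.2 fun i => ae_tendsto_supCyl_average G hmix hF (hf i)] with x hx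
  obtain ⟨θt, hmax, hlim⟩ := exists_maximizers_tendsto hconv
    (fun t => pressure_ge_tangent G hmix hf₀ hf θ₀ t) hx
  refine ⟨θt, hmax.mono fun n hn => ⟨fun t => ?_, fun t ht => hn.2 t fun t' => ?_⟩, hlim⟩
  · have := hn.1 t
    simp only [MPEobjective, Fvec, Fin.cons_succ]
    linarith
  · have := ht t'
    simp only [MPEobjective, Fvec, Fin.cons_succ] at this
    linarith

end GibbsPaper
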